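/- Convergence of the CVaR policy iteration algorithm: assume π^d(i) > 0 for every deterministic policy d and every i ∈ S, and for each deterministic policy d fix a solution g_d of the Poisson equation for d at VaR^d, and define Q_d(i,a) := c̃(VaR^d,i,a) + Σ_{j∈S} p(j|i,a)·g_d(j). Let T be a map on deterministic policies such that for every d and i: Q_d(i,(Td)(i)) = min_{a∈A} Q_d(i,a), and (Td)(i) = d(i) whenever Q_d(i,d(i)) = min_{a∈A} Q_d(i,a). Then: (a) if Td ≠ d then CVaR^{Td} < CVaR^{d}; (b) for any initial deterministic policy d⁰, the sequence d^{l+1} := T d^{l} is eventually constant, and its eventual value d̄ satisfies Q_{d̄}(i, d̄(i)) = min_{a∈A} Q_{d̄}(i,a) for all i ∈ S (the Bellman local optimality equation). -/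

import Mathlib

/-- The pseudo-CVaR cost `c̃(y,i,a) = y + (1-α)⁻¹ max(c(i,a) - y, 0)`. -/
noncomputable def ctil {S A : Type*} (α : ℝ) (c : S → A → ℝ) (y : ℝ) (i : S) (a : A) : ℝ :=
  y + (1 - α)⁻¹ * max (c i a - y) 0

/-- The pseudo CVaR `ṼC^d(y) = Σ_i π(i) c̃(y,i,d(i))` of a deterministic policy `d`
with stationary distribution `π`. -/
noncomputable def pC {S A : Type*} [Fintype S] (α : ℝ) (c : S → A → ℝ) (π : S → ℝ)
    (d : S → A) (y : ℝ) : ℝ :=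
  ∑ i, π i * ctil α c y i (d i)

/-- The long-run CVaR `CVaR^d = inf_{y ∈ ℝ} ṼC^d(y)`. -/
noncomputable def CV {S A : Type*} [Fintype S] (α : ℝ) (c : S → A → ℝ) (π : S → ℝ)
    (d : S → A) : ℝ :=
  sInf (Set.range (pC α c π d))

/-- The long-run VaR `VaR^d = inf {w : Σ_{i : c(i,d(i)) ≤ w} π(i) ≥ α}`. -/
noncomputable def VaR {S A : Type*} [Fintype S] (α : ℝ) (c : S → A → ℝ) (π : S → ℝ)
    (d : S → A) : ℝ :=
  sInf {w : ℝ | α ≤ ∑ i, if c i (d i) ≤ w then π i else 0}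

/-- The Q-function `Q_d(i,a) = c̃(VaR^d, i, a) + Σ_j p(j|i,a) g_d(j)` used in the CVaR
policy iteration algorithm. -/
noncomputable def Qfun {S A : Type*} [Fintype S] (α : ℝ) (p : S → A → S → ℝ)
    (c : S → A → ℝ) (sd : (S → A) → S → ℝ) (G : (S → A) → S → ℝ)
    (d : S → A) (i : S) (a : A) : ℝ :=
  ctil α c (VaR α c (sd d) d) i a + ∑ j, p i a j * G d j

open Filter Topology in
/-- A quantile `v` of a finite distribution at level `α`: the mass up to `v` is at least `α`,
and the mass strictly below `v` is at most `α`. -/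
theorem VaR_isQuantile {S A : Type*} [Fintype S] [Nonempty S] (c : S → A → ℝ) {α : ℝ}
    (hα : α ∈ Set.Ioo (0 : ℝ) 1) {π : S → ℝ} (h0 : ∀ i, 0 ≤ π i) (h1 : ∑ i, π i = 1)
    (d : S → A) :
    (α ≤ ∑ i, if c i (d i) ≤ VaR α c π d then π i else 0) ∧
      (∑ i, if c i (d i) < VaR α c π d then π i else 0) ≤ α := by
  set W : Set ℝ := {w : ℝ | α ≤ ∑ i, if c i (d i) ≤ w then π i else 0} with hW
  have hV : VaR α c π d = sInf W := rfl
  rw [hV]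
  have hne : W.Nonempty := by
    obtain ⟨M, hM⟩ := (Set.finite_range fun i => c i (d i)).bddAbove
    refine ⟨M, ?_⟩
    have hle : ∀ i, c i (d i) ≤ M := fun i => hM ⟨i, rfl⟩
    simp [hW, hle, h1, hα.2.le]
  have hbdd : BddBelow W := by
    obtain ⟨m, hm⟩ := (Set.finite_range fun i => c i (d i)).bddBelow
    refine ⟨m, fun w hw => ?_⟩
    by_contra! hlt
    have hnot : ∀ i, ¬ c i (d i) ≤ w := fun i => not_le.2 (hlt.trans_le (hm ⟨i, rfl⟩))
    simp only [hW, Set.mem_ofPred_eq, hnot, if_false, Finset.sum_const_zero] at hw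
    exact absurd hα.1 (not_lt.2 hw)
  constructor
  · have hev : ∀ᶠ w in 𝓝[>] sInf W, ∀ i, c i (d i) ≤ w → c i (d i) ≤ sInf W := by
      rw [eventually_all]
      intro i
      rcases le_or_gt (c i (d i)) (sInf W) with h | h
      · exact Eventually.of_forall fun _ _ => h
      · filter_upwards [Ioo_mem_nhdsGT h] with w hw hc
        exact absurd hc (not_le.2 hw.2)
    obtain ⟨w, hw, hlt⟩ := (hev.and self_mem_nhdsWithin).exists
    obtain ⟨u, hu, huw⟩ := exists_lt_of_csInf_lt hne hlt
    refine le_trans hu (Finset.sum_le_sum fun i _ => ?_)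
    have := hw i
    have := h0 i
    split_ifs <;> grind
  · have hev : ∀ᶠ w in 𝓝[<] sInf W, ∀ i, c i (d i) < sInf W → c i (d i) ≤ w := by
      rw [eventually_all]
      intro i
      rcases lt_or_ge (c i (d i)) (sInf W) with h | h
      · filter_upwards [Ioo_mem_nhdsLT h] with w hw _
        exact hw.1.le
      · exact Eventually.of_forall fun _ hc => absurd hc (not_lt.2 h)
    obtain ⟨w, hw, hlt⟩ := (hev.and self_mem_nhdsWithin).exists
    have hnot : w ∉ W := fun hmem => absurd (csInf_le hbdd hmem) (not_le.2 hlt)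
    refine le_trans (Finset.sum_le_sum fun i _ => ?_) (not_le.1 hnot).le
    have := hw i
    have := h0 i
    split_ifs <;> grind

/-- The pseudo CVaR of a policy is minimized at its VaR. -/
theorem pC_VaR_le {S A : Type*} [Fintype S] [Nonempty S] (c : S → A → ℝ) {α : ℝ}
    (hα : α ∈ Set.Ioo (0 : ℝ) 1) {π : S → ℝ} (h0 : ∀ i, 0 ≤ π i) (h1 : ∑ i, π i = 1)
    (d : S → A) (y : ℝ) :
    pC α c π d (VaR α c π d) ≤ pC α c π d y := by
  obtain ⟨hge, hle⟩ := VaR_isQuantile c hα h0 h1 d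
  generalize VaR α c π d = v at *
  have hexp : ∀ z, pC α c π d z = z + (1 - α)⁻¹ * ∑ i, π i * max (c i (d i) - z) 0 := by
    intro z
    simp only [pC, ctil, mul_add, Finset.sum_add_distrib, ← Finset.sum_mul, h1, one_mul,
      Finset.mul_sum]
    congr 1
    exact Finset.sum_congr rfl fun i _ => by ring
  have hpos : 0 < 1 - α := sub_pos.2 hα.2
  have hkey : (1 - α) * (v - y) ≤ (∑ i, π i * max (c i (d i) - y) 0) -
      ∑ i, π i * max (c i (d i) - v) 0 := by
    rw [← Finset.sum_sub_distrib]
    rcases le_total v y with h | h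
    · calc (1 - α) * (v - y)
          ≤ (∑ i, π i - ∑ i, if c i (d i) ≤ v then π i else 0) * (v - y) := by
            rw [h1]; nlinarith
        _ = ∑ i, (π i - if c i (d i) ≤ v then π i else 0) * (v - y) := by
            rw [← Finset.sum_sub_distrib, Finset.sum_mul]
        _ ≤ _ := Finset.sum_le_sum fun i _ => by
            rw [← mul_sub]
            split_ifs with hc
            · rw [sub_self, zero_mul, max_eq_right (by linarith : c i (d i) - y ≤ 0),
                max_eq_right (by linarith : c i (d i) - v ≤ 0), sub_self, mul_zero]
            · rw [sub_zero, max_eq_left (by linarith : 0 ≤ c i (d i) - v)]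
              exact mul_le_mul_of_nonneg_left
                (by linarith [le_max_left (c i (d i) - y) 0]) (h0 i)
    · calc (1 - α) * (v - y)
          ≤ (∑ i, π i - ∑ i, if c i (d i) < v then π i else 0) * (v - y) := by
            rw [h1]; nlinarith
        _ = ∑ i, (π i - if c i (d i) < v then π i else 0) * (v - y) := by
            rw [← Finset.sum_sub_distrib, Finset.sum_mul]
        _ ≤ _ := Finset.sum_le_sum fun i _ => by
            rw [← mul_sub]
            split_ifs with hc
            · rw [sub_self, zero_mul, max_eq_right (by linarith : c i (d i) - v ≤ 0), sub_zero]
              exact mul_nonneg (h0 i) (le_max_right _ _)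
            · rw [sub_zero, max_eq_left (by linarith : 0 ≤ c i (d i) - v)]
              exact mul_le_mul_of_nonneg_left
                (by linarith [le_max_left (c i (d i) - y) 0]) (h0 i)
  rw [hexp, hexp]
  have := (le_inv_mul_iff₀ hpos).2 hkey
  rw [mul_sub] at this
  linarith

/-- The long-run CVaR is the pseudo CVaR at the VaR. -/
theorem CV_eq_pC_VaR {S A : Type*} [Fintype S] [Nonempty S] (c : S → A → ℝ) {α : ℝ}
    (hα : α ∈ Set.Ioo (0 : ℝ) 1) {π : S → ℝ} (h0 : ∀ i, 0 ≤ π i) (h1 : ∑ i, π i = 1)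
    (d : S → A) :
    CV α c π d = pC α c π d (VaR α c π d) :=
  IsLeast.csInf_eq ⟨⟨_, rfl⟩, Set.forall_mem_range.2 (pC_VaR_le c hα h0 h1 d)⟩

/-- The average of `Q_d(·, e(·))` under a stationary distribution of `e` is the pseudo CVaR of
`e` at `VaR^d` plus the average of the bias function of `d`. -/
theorem sum_mul_Qfun_eq {S A : Type*} [Fintype S] (p : S → A → S → ℝ) (c : S → A → ℝ) (α : ℝ)
    (sd : (S → A) → S → ℝ) (G : (S → A) → S → ℝ) (d e : S → A)
    (hstat : ∀ j : S, ∑ i, sd e i * p i (e i) j = sd e j) :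
    ∑ i, sd e i * Qfun α p c sd G d i (e i) =
      pC α c (sd e) e (VaR α c (sd d) d) + ∑ i, sd e i * G d i := by
  simp only [Qfun, pC, mul_add, Finset.sum_add_distrib]
  congr 1
  simp only [Finset.mul_sum, ← mul_assoc]
  rw [Finset.sum_comm]
  simp only [← Finset.sum_mul, hstat]

/-- An iteration on a finite type that strictly decreases a real potential whenever it moves
reaches a fixed point. -/
theorem exists_iterate_fixed_of_strict_decrease {X : Type*} [Finite X] (T : X → X) (f : X → ℝ)
    (hT : ∀ x, T x ≠ x → f (T x) < f x) (x : X) : ∃ n, T (T^[n] x) = T^[n] x := by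
  by_contra! h
  have hanti : StrictAnti fun n => f (T^[n] x) := strictAnti_nat_of_succ_lt fun n => by
    rw [Function.iterate_succ_apply']
    exact hT _ (h n)
  exact not_injective_infinite_finite (fun n => T^[n] x)
    fun m n hmn => hanti.injective (congrArg f hmn)

/-- Convergence of the CVaR policy iteration algorithm: (a) a nontrivial
improvement step strictly decreases the long-run CVaR; (b) the iterates are eventually
constant and the limiting policy satisfies the Bellman local optimality equation. -/
theorem cvar_policy_iteration_converges
    {S A : Type*} [Fintype S] [Fintype A] [Nonempty S] [Nonempty A]
    (p : S → A → S → ℝ) (hp0 : ∀ i a j, 0 ≤ p i a j) (hp1 : ∀ i a, ∑ j, p i a j = 1)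
    (c : S → A → ℝ) (α : ℝ) (hα : α ∈ Set.Ioo (0 : ℝ) 1)
    (sd : (S → A) → S → ℝ)
    (hsd0 : ∀ d i, 0 < sd d i) (hsd1 : ∀ d, ∑ i, sd d i = 1)
    (hsdstat : ∀ (d : S → A) (j : S), ∑ i, sd d i * p i (d i) j = sd d j)
    (G : (S → A) → S → ℝ)
    (hG : ∀ (d : S → A) (i : S),
      G d i = ctil α c (VaR α c (sd d) d) i (d i) - pC α c (sd d) d (VaR α c (sd d) d) +
        ∑ j, p i (d i) j * G d j)
    (T : (S → A) → S → A)
    (hTmin : ∀ (d : S → A) (i : S),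
      Qfun α p c sd G d i (T d i) = ⨅ a : A, Qfun α p c sd G d i a)
    (hTkeep : ∀ (d : S → A) (i : S),
      Qfun α p c sd G d i (d i) = (⨅ a : A, Qfun α p c sd G d i a) → T d i = d i) :
    (∀ d : S → A, T d ≠ d → CV α c (sd (T d)) (T d) < CV α c (sd d) d) ∧
    (∀ d0 : S → A, ∃ N : ℕ,
      (∀ n : ℕ, N ≤ n → T^[n] d0 = T^[N] d0) ∧
      (∀ i : S, Qfun α p c sd G (T^[N] d0) i ((T^[N] d0) i) =
        ⨅ a : A, Qfun α p c sd G (T^[N] d0) i a)) := by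
  have hinf_le : ∀ (d : S → A) (i : S) (a : A),
      (⨅ a : A, Qfun α p c sd G d i a) ≤ Qfun α p c sd G d i a :=
    fun d i a => ciInf_le (Set.finite_range _).bddBelow a
  have hdec : ∀ d : S → A, T d ≠ d → CV α c (sd (T d)) (T d) < CV α c (sd d) d := by
    intro d hd
    have h0 : ∀ d i, 0 ≤ sd d i := fun d i => (hsd0 d i).le
    rw [CV_eq_pC_VaR c hα (h0 _) (hsd1 _), CV_eq_pC_VaR c hα (h0 _) (hsd1 _)]
    refine (pC_VaR_le c hα (h0 _) (hsd1 _) _ (VaR α c (sd d) d)).trans_lt ?_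
    obtain ⟨k, hk⟩ := Function.ne_iff.1 hd
    have hlt : ∑ i, sd (T d) i * Qfun α p c sd G d i (T d i) <
        ∑ i, sd (T d) i * Qfun α p c sd G d i (d i) := by
      refine Finset.sum_lt_sum (fun i _ => mul_le_mul_of_nonneg_left ?_ (h0 _ i))
        ⟨k, Finset.mem_univ k, mul_lt_mul_of_pos_left ?_ (hsd0 _ k)⟩
      · rw [hTmin]
        exact hinf_le d i (d i)
      · rw [hTmin]
        exact (hinf_le d k (d k)).lt_of_ne fun h => hk (hTkeep d k h.symm)
    have hQ : ∀ i, Qfun α p c sd G d i (d i) = pC α c (sd d) d (VaR α c (sd d) d) + G d i := by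
      intro i
      rw [Qfun]
      linarith [hG d i]
    rw [sum_mul_Qfun_eq p c α sd G d (T d) (hsdstat _)] at hlt
    simp only [hQ, mul_add, Finset.sum_add_distrib, ← Finset.sum_mul, hsd1, one_mul] at hlt
    linarith
  refine ⟨hdec, fun d0 => ?_⟩
  obtain ⟨N, hN⟩ := exists_iterate_fixed_of_strict_decrease T (fun d => CV α c (sd d) d) hdec d0
  refine ⟨N, fun n hn => ?_, fun i => ?_⟩
  · obtain ⟨k, rfl⟩ := Nat.exists_eq_add_of_le' hn
    rw [Function.iterate_add_apply, Function.iterate_fixed hN]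
  · rw [← hTmin, hN]
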